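/- Let P be a Poisson vertex algebra with conformal vector L of central charge c ∈ C. Suppose there exist L-primary elements G and a_i (i ∈ I) such that G is odd, {G_λ G} = L + (λ²/3)c, {G_λ a_i} = G_{(0)}a_i for all i ∈ I, and the set {G, L} ∪ {a_i, G_{(0)}a_i : i ∈ I} freely generates P as a C[∂]-differential algebra. Then, setting D := G_{(0)}, P with the induced Λ-bracket {a_Λ b} = {Da_λ b} + χ{a_λ b} is an N=1 SUSY PVA with N=1 superconformal vector G; moreover P is freely generated by {G} ∪ {a_i : i ∈ I} as a C[∂,D]-algebra, where all a_i are G-primary. -/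

import Mathlib

noncomputable section

/-- The sign `(-1)^{ij}` for parities `i, j : ZMod 2`. -/
def sg (i j : ZMod 2) : ℂ := (-1 : ℂ) ^ (i.val * j.val)

/-- The sign `(-1)^{i}` for a parity `i : ZMod 2`. -/
def sg1 (i : ZMod 2) : ℂ := (-1 : ℂ) ^ i.val

/-- The data of a Poisson vertex algebra structure on a unital associative
`ℂ`-superalgebra `P`: a `ℤ/2`-grading `part`, an even derivation `∂ = der`,
and a `λ`-bracket `{a_λ b} = ∑_{n≥0} (λⁿ/n!) (lb a b n)` with a support bound
`bnd`. -/
structure PVAData (P : Type) [Ring P] [Algebra ℂ P] where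
  part : ZMod 2 → Submodule ℂ P
  der : P →ₗ[ℂ] P
  lb : P →ₗ[ℂ] P →ₗ[ℂ] (ℕ → P)
  bnd : P → P → ℕ

namespace PVAData

variable {P : Type} [Ring P] [Algebra ℂ P] (d : PVAData P)

/-- The axioms of a Poisson vertex algebra (with its `ℤ/2`-grading):
`P` is a unital supercommutative associative differential superalgebra, and
the `λ`-bracket (written in coefficients, `{a_λ b} = ∑ λⁿ/n! · lb a b n`)
satisfies sesquilinearity, skewsymmetry, the Jacobi identity and the Leibniz
rule. -/
structure IsPVA : Prop where
  compl : IsCompl (d.part 0) (d.part 1)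
  one_mem : (1 : P) ∈ d.part 0
  mul_mem : ∀ (i j : ZMod 2), ∀ a ∈ d.part i, ∀ b ∈ d.part j,
    a * b ∈ d.part (i + j)
  scomm : ∀ (i j : ZMod 2), ∀ a ∈ d.part i, ∀ b ∈ d.part j,
    a * b = sg i j • (b * a)
  der_mem : ∀ (i : ZMod 2), ∀ a ∈ d.part i, d.der a ∈ d.part i
  der_mul : ∀ a b : P, d.der (a * b) = d.der a * b + a * d.der b
  lb_mem : ∀ (i j : ZMod 2), ∀ a ∈ d.part i, ∀ b ∈ d.part j, ∀ n,
    d.lb a b n ∈ d.part (i + j)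
  lb_bnd : ∀ a b n, d.bnd a b ≤ n → d.lb a b n = 0
  -- sesquilinearity: `{∂a_λ b} = -λ{a_λ b}`, `{a_λ ∂b} = (∂+λ){a_λ b}`
  sesq1₀ : ∀ a b : P, d.lb (d.der a) b 0 = 0
  sesq1 : ∀ (a b : P) (n : ℕ),
    d.lb (d.der a) b (n + 1) = -((n + 1 : ℕ) : ℂ) • d.lb a b n
  sesq2₀ : ∀ a b : P, d.lb a (d.der b) 0 = d.der (d.lb a b 0)
  sesq2 : ∀ (a b : P) (n : ℕ), d.lb a (d.der b) (n + 1) =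
    d.der (d.lb a b (n + 1)) + ((n + 1 : ℕ) : ℂ) • d.lb a b n
  -- skewsymmetry: `{a_λ b} = -(-1)^{p(a)p(b)} {b_{-λ-∂} a}`
  skew : ∀ (i j : ZMod 2), ∀ a ∈ d.part i, ∀ b ∈ d.part j, ∀ n,
    d.lb a b n = -sg i j • ∑ k ∈ Finset.range (d.bnd b a + 1),
      (((-1 : ℂ) ^ (n + k)) / (Nat.factorial k : ℂ)) •
        (d.der ^ k) (d.lb b a (n + k))
  -- Jacobi identity:
  -- `{a_λ{b_γ c}} = {{a_λ b}_{λ+γ} c} + (-1)^{p(a)p(b)}{b_γ{a_λ c}}`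
  jacobi : ∀ (i j : ZMod 2), ∀ a ∈ d.part i, ∀ b ∈ d.part j, ∀ (c : P)
    (m n : ℕ), d.lb a (d.lb b c n) m =
      (∑ k ∈ Finset.range (m + 1),
        ((Nat.choose m k : ℕ) : ℂ) • d.lb (d.lb a b k) c (m + n - k)) +
      sg i j • d.lb b (d.lb a c m) n
  -- Leibniz rule: `{a_λ bc} = {a_λ b}c + (-1)^{p(a)p(b)} b{a_λ c}`
  leibniz : ∀ (i j : ZMod 2), ∀ a ∈ d.part i, ∀ b ∈ d.part j, ∀ (c : P) (n : ℕ),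
    d.lb a (b * c) n = d.lb a b n * c + sg i j • (b * d.lb a c n)

/-- The conformal weight space `P_Δ` of quasi-primary vectors for a candidate
conformal vector `L`: elements `a` with
`{L_λ a} = (2∂ + 2Δλ)a + O(λ²)`. -/
def confWtSet (L : P) (Δ : ℝ) : Set P :=
  {a | d.lb L a 0 = (2 : ℂ) • d.der a ∧ d.lb L a 1 = ((2 * Δ : ℝ) : ℂ) • a}

/-- `L` is a conformal vector of central charge `c`:
`{L_λ L} = (2∂ + 4λ)L + (λ³/3)c` and `P` is the (bounded-below) sum of its
conformal weight spaces. -/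
def IsConformalVector (L : P) (c : ℂ) : Prop :=
  L ∈ d.part 0 ∧
  d.lb L L 0 = (2 : ℂ) • d.der L ∧
  d.lb L L 1 = (4 : ℂ) • L ∧
  d.lb L L 2 = 0 ∧
  d.lb L L 3 = (2 * c) • (1 : P) ∧
  (∀ n, 4 ≤ n → d.lb L L n = 0) ∧
  ∃ M : ℝ, (∀ Δ : ℝ, Δ < M → d.confWtSet L Δ ⊆ {0}) ∧
    Submodule.span ℂ (⋃ Δ : ℝ, d.confWtSet L Δ) = ⊤

/-- `a` is primary of conformal weight `Δ` with respect to `L`: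
`{L_λ a} = (2∂ + 2Δλ)a` exactly. -/
def IsPrimary (L a : P) (Δ : ℝ) : Prop :=
  d.lb L a 0 = (2 : ℂ) • d.der a ∧
  d.lb L a 1 = ((2 * Δ : ℝ) : ℂ) • a ∧
  ∀ n, 2 ≤ n → d.lb L a n = 0

end PVAData
/-- The data of an `N=1` SUSY Poisson vertex algebra structure on a unital
associative `ℂ`-superalgebra `P`: a `ℤ/2`-grading `part`, the even derivation
`∂ = der` and odd derivation `D = sder`, and the `Λ`-bracket
`{a_Λ b} = ∑_{n≥0} (λⁿ/n!) (lb0 a b n + χ · lb1 a b n)`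
(components `lb0 a b n = a_{(n|0)} b`, `lb1 a b n = a_{(n|1)} b`). -/
structure SPVAData (P : Type) [Ring P] [Algebra ℂ P] where
  part : ZMod 2 → Submodule ℂ P
  der : P →ₗ[ℂ] P
  sder : P →ₗ[ℂ] P
  lb0 : P →ₗ[ℂ] P →ₗ[ℂ] (ℕ → P)
  lb1 : P →ₗ[ℂ] P →ₗ[ℂ] (ℕ → P)
  bnd : P → P → ℕ

namespace SPVAData

variable {P : Type} [Ring P] [Algebra ℂ P] (d : SPVAData P)

/-- The axioms of an `N=1` SUSY Poisson vertex algebra, in terms of the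
coefficients of the `Λ`-bracket
`{a_Λ b} = ∑_m (λᵐ/m!)(a_{(m|0)}b + χ a_{(m|1)}b)`, `Λ = (λ,χ)`, χ² = -λ:
`P` is a unital supercommutative associative superalgebra with even derivation
`∂` and odd derivation `D`, `D² = ∂`, and the bracket is odd and satisfies
sesquilinearity (`{Da_Λ b} = χ{a_Λ b}`,
`{a_Λ Db} = (-1)^{p(a)+1}(D+χ){a_Λ b}`), skewsymmetry
(`{a_Λ b} = (-1)^{p(a)p(b)}{b_{-Λ-∇} a}`), the `N=1` SUSY Jacobi identity and
the Leibniz rule. -/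
structure IsSPVA : Prop where
  compl : IsCompl (d.part 0) (d.part 1)
  one_mem : (1 : P) ∈ d.part 0
  mul_mem : ∀ (i j : ZMod 2), ∀ a ∈ d.part i, ∀ b ∈ d.part j,
    a * b ∈ d.part (i + j)
  scomm : ∀ (i j : ZMod 2), ∀ a ∈ d.part i, ∀ b ∈ d.part j,
    a * b = sg i j • (b * a)
  der_mem : ∀ (i : ZMod 2), ∀ a ∈ d.part i, d.der a ∈ d.part i
  der_mul : ∀ a b : P, d.der (a * b) = d.der a * b + a * d.der b
  sder_mem : ∀ (i : ZMod 2), ∀ a ∈ d.part i, d.sder a ∈ d.part (i + 1)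
  sder_mul : ∀ (i : ZMod 2), ∀ a ∈ d.part i, ∀ b : P,
    d.sder (a * b) = d.sder a * b + sg1 i • (a * d.sder b)
  sder_sq : ∀ a : P, d.sder (d.sder a) = d.der a
  lb0_mem : ∀ (i j : ZMod 2), ∀ a ∈ d.part i, ∀ b ∈ d.part j, ∀ n,
    d.lb0 a b n ∈ d.part (i + j + 1)
  lb1_mem : ∀ (i j : ZMod 2), ∀ a ∈ d.part i, ∀ b ∈ d.part j, ∀ n,
    d.lb1 a b n ∈ d.part (i + j)
  lb0_bnd : ∀ a b n, d.bnd a b ≤ n → d.lb0 a b n = 0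
  lb1_bnd : ∀ a b n, d.bnd a b ≤ n → d.lb1 a b n = 0
  -- sesquilinearity in the first argument: `{Da_Λ b} = χ{a_Λ b}`
  sesq1₀ : ∀ a b : P, d.lb0 (d.sder a) b 0 = 0
  sesq1 : ∀ (a b : P) (n : ℕ),
    d.lb0 (d.sder a) b (n + 1) = -((n + 1 : ℕ) : ℂ) • d.lb1 a b n
  sesq1' : ∀ (a b : P) (n : ℕ), d.lb1 (d.sder a) b n = d.lb0 a b n
  -- sesquilinearity in the second argument:
  -- `{a_Λ Db} = (-1)^{p(a)+1}(D+χ){a_Λ b}`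
  sesq2₀ : ∀ (i : ZMod 2), ∀ a ∈ d.part i, ∀ b : P,
    d.lb0 a (d.sder b) 0 = sg1 (i + 1) • d.sder (d.lb0 a b 0)
  sesq2 : ∀ (i : ZMod 2), ∀ a ∈ d.part i, ∀ (b : P) (n : ℕ),
    d.lb0 a (d.sder b) (n + 1) = sg1 (i + 1) •
      (d.sder (d.lb0 a b (n + 1)) + ((n + 1 : ℕ) : ℂ) • d.lb1 a b n)
  sesq2' : ∀ (i : ZMod 2), ∀ a ∈ d.part i, ∀ (b : P) (n : ℕ),
    d.lb1 a (d.sder b) n = sg1 (i + 1) •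
      (d.lb0 a b n - d.sder (d.lb1 a b n))
  -- skewsymmetry: `{a_Λ b} = (-1)^{p(a)p(b)} {b_{-Λ-∇} a}`
  skew0 : ∀ (i j : ZMod 2), ∀ a ∈ d.part i, ∀ b ∈ d.part j, ∀ n,
    d.lb0 a b n = sg i j • ∑ k ∈ Finset.range (d.bnd b a + 1),
      (((-1 : ℂ) ^ (n + k)) / (Nat.factorial k : ℂ)) •
        (d.der ^ k) (d.lb0 b a (n + k) - d.sder (d.lb1 b a (n + k)))
  skew1 : ∀ (i j : ZMod 2), ∀ a ∈ d.part i, ∀ b ∈ d.part j, ∀ n,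
    d.lb1 a b n = -sg i j • ∑ k ∈ Finset.range (d.bnd b a + 1),
      (((-1 : ℂ) ^ (n + k)) / (Nat.factorial k : ℂ)) •
        (d.der ^ k) (d.lb1 b a (n + k))
  -- the `N=1` SUSY Jacobi identity
  -- `{a_Λ{b_Γ c}} = (-1)^{p(a)+1}{{a_Λ b}_{Γ+Λ} c}
  --                + (-1)^{(p(a)+1)(p(b)+1)}{b_Γ{a_Λ c}}`,
  -- written out in the components `1, χ, η, χη` of `C[λ,γ,χ,η] ⊗ P`
  jacobi00 : ∀ (i j : ZMod 2), ∀ a ∈ d.part i, ∀ b ∈ d.part j, ∀ (c : P)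
    (m n : ℕ), d.lb0 a (d.lb0 b c n) m = sg1 (i + 1) •
      ((∑ k ∈ Finset.range (m + 1),
        ((Nat.choose m k : ℕ) : ℂ) • d.lb0 (d.lb0 a b k) c (m + n - k)) +
       (∑ k ∈ Finset.range m,
        (((k + 1) * Nat.choose m (k + 1) : ℕ) : ℂ) •
          d.lb1 (d.lb1 a b k) c (m + n - k - 1))) +
      sg (i + 1) (j + 1) • d.lb0 b (d.lb0 a c m) n
  jacobi10 : ∀ (i j : ZMod 2), ∀ a ∈ d.part i, ∀ b ∈ d.part j, ∀ (c : P)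
    (m n : ℕ), d.lb1 a (d.lb0 b c n) m = sg1 (i + 1) •
      (∑ k ∈ Finset.range (m + 1), ((Nat.choose m k : ℕ) : ℂ) •
        (d.lb1 (d.lb0 a b k) c (m + n - k) - d.lb0 (d.lb1 a b k) c (m + n - k))) +
      (sg (i + 1) (j + 1) * sg1 (j + 1)) • d.lb0 b (d.lb1 a c m) n
  jacobi01 : ∀ (i j : ZMod 2), ∀ a ∈ d.part i, ∀ b ∈ d.part j, ∀ (c : P)
    (m n : ℕ), sg1 (i + 1) • d.lb0 a (d.lb1 b c n) m = sg1 (i + 1) •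
      (∑ k ∈ Finset.range (m + 1),
        ((Nat.choose m k : ℕ) : ℂ) • d.lb1 (d.lb0 a b k) c (m + n - k)) +
      sg (i + 1) (j + 1) • d.lb1 b (d.lb0 a c m) n
  jacobi11 : ∀ (i j : ZMod 2), ∀ a ∈ d.part i, ∀ b ∈ d.part j, ∀ (c : P)
    (m n : ℕ), sg1 i • d.lb1 a (d.lb1 b c n) m = sg1 i •
      (∑ k ∈ Finset.range (m + 1),
        ((Nat.choose m k : ℕ) : ℂ) • d.lb1 (d.lb1 a b k) c (m + n - k)) +
      (sg (i + 1) (j + 1) * sg1 (j + 1)) • d.lb1 b (d.lb1 a c m) n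
  -- the Leibniz rule `{a_Λ bc} = {a_Λ b}c + (-1)^{(p(a)+1)p(b)} b{a_Λ c}`
  leibniz0 : ∀ (i j : ZMod 2), ∀ a ∈ d.part i, ∀ b ∈ d.part j, ∀ (c : P) (n : ℕ),
    d.lb0 a (b * c) n = d.lb0 a b n * c + sg (i + 1) j • (b * d.lb0 a c n)
  leibniz1 : ∀ (i j : ZMod 2), ∀ a ∈ d.part i, ∀ b ∈ d.part j, ∀ (c : P) (n : ℕ),
    d.lb1 a (b * c) n = d.lb1 a b n * c + sg i j • (b * d.lb1 a c n)

/-- The conformal weight space of quasi-primary vectors for a candidate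
`N=1` superconformal vector `G`: elements `a` with
`{G_Λ a} = (2∂ + 2Δλ + χD)a + O(Λ²)`. -/
def sconfWtSet (G : P) (Δ : ℝ) : Set P :=
  {a | d.lb0 G a 0 = (2 : ℂ) • d.der a ∧
       d.lb0 G a 1 = ((2 * Δ : ℝ) : ℂ) • a ∧
       d.lb1 G a 0 = d.sder a}

/-- `G` is an `N=1` superconformal vector of central charge `c`:
`G` is odd, `{G_Λ G} = (2∂ + 3λ + χD)G + (λ²χ/3)c`, and `P` is the
(bounded-below) sum of the conformal weight spaces of `G`. -/
def IsSuperconformal (G : P) (c : ℂ) : Prop :=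
  G ∈ d.part 1 ∧
  d.lb0 G G 0 = (2 : ℂ) • d.der G ∧
  d.lb0 G G 1 = (3 : ℂ) • G ∧
  (∀ n, 2 ≤ n → d.lb0 G G n = 0) ∧
  d.lb1 G G 0 = d.sder G ∧
  d.lb1 G G 1 = 0 ∧
  d.lb1 G G 2 = (2 * c / 3) • (1 : P) ∧
  (∀ n, 3 ≤ n → d.lb1 G G n = 0) ∧
  ∃ M : ℝ, (∀ Δ : ℝ, Δ < M → d.sconfWtSet G Δ ⊆ {0}) ∧
    Submodule.span ℂ (⋃ Δ : ℝ, d.sconfWtSet G Δ) = ⊤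

/-- `a` is primary of conformal weight `Δ` with respect to the `N=1`
superconformal vector `G`: `{G_Λ a} = (2∂ + 2Δλ + χD)a` exactly. -/
def IsPrimary (G a : P) (Δ : ℝ) : Prop :=
  d.lb0 G a 0 = (2 : ℂ) • d.der a ∧
  d.lb0 G a 1 = ((2 * Δ : ℝ) : ℂ) • a ∧
  (∀ n, 2 ≤ n → d.lb0 G a n = 0) ∧
  d.lb1 G a 0 = d.sder a ∧
  (∀ n, 1 ≤ n → d.lb1 G a n = 0)

end SPVAData
/-- The data of an `N=2` SUSY Poisson vertex algebra structure: a
`ℤ/2`-grading, the even derivation `∂ = der`, two odd derivations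
`D = sder1`, `D̃ = sder2`, and the `Λ`-bracket
`{a_Λ b} = ∑_n (λⁿ/n!)(a_{(n|00)}b - χ a_{(n|10)}b + χ̃ a_{(n|01)}b
- χχ̃ a_{(n|11)}b)`, with components `lb00, lb10, lb01, lb11`. -/
structure S2PVAData (P : Type) [Ring P] [Algebra ℂ P] where
  part : ZMod 2 → Submodule ℂ P
  der : P →ₗ[ℂ] P
  sder1 : P →ₗ[ℂ] P
  sder2 : P →ₗ[ℂ] P
  lb00 : P →ₗ[ℂ] P →ₗ[ℂ] (ℕ → P)
  lb10 : P →ₗ[ℂ] P →ₗ[ℂ] (ℕ → P)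
  lb01 : P →ₗ[ℂ] P →ₗ[ℂ] (ℕ → P)
  lb11 : P →ₗ[ℂ] P →ₗ[ℂ] (ℕ → P)
  bnd : P → P → ℕ

namespace S2PVAData

variable {P : Type} [Ring P] [Algebra ℂ P] (d : S2PVAData P)

/-- The underlying `N=0` Poisson vertex algebra data, with `λ`-bracket the
`(n|11)`-component of the `Λ`-bracket. -/
def toPVAData : PVAData P :=
  { part := d.part, der := d.der, lb := d.lb11, bnd := d.bnd }

/-- The axioms of an `N=2` SUSY Poisson vertex algebra.  By the sesquilinearity
of the `Λ`-bracket, an `N=2` SUSY PVA structure is equivalent to the data of a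
Poisson vertex algebra structure for the `λ`-bracket
`{a_λ b} = ∑ (λⁿ/n!) a_{(n|11)} b` together with two supercommuting odd
derivations `D, D̃` with `D² = D̃² = ∂`, both compatible with the `λ`-bracket,
the remaining components being recovered by
`{a_Λ b} = {D̃Da_λ b} - χ{D̃a_λ b} + χ̃{Da_λ b} - χχ̃{a_λ b}`;
this is the form in which we state the axioms. -/
structure IsS2PVA : Prop where
  pva : d.toPVAData.IsPVA
  sder1_mem : ∀ (i : ZMod 2), ∀ a ∈ d.part i, d.sder1 a ∈ d.part (i + 1)
  sder2_mem : ∀ (i : ZMod 2), ∀ a ∈ d.part i, d.sder2 a ∈ d.part (i + 1)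
  sder1_mul : ∀ (i : ZMod 2), ∀ a ∈ d.part i, ∀ b : P,
    d.sder1 (a * b) = d.sder1 a * b + sg1 i • (a * d.sder1 b)
  sder2_mul : ∀ (i : ZMod 2), ∀ a ∈ d.part i, ∀ b : P,
    d.sder2 (a * b) = d.sder2 a * b + sg1 i • (a * d.sder2 b)
  sder1_sq : ∀ a : P, d.sder1 (d.sder1 a) = d.der a
  sder2_sq : ∀ a : P, d.sder2 (d.sder2 a) = d.der a
  anticomm : ∀ a : P, d.sder1 (d.sder2 a) + d.sder2 (d.sder1 a) = 0
  sder1_lb : ∀ (i : ZMod 2), ∀ a ∈ d.part i, ∀ (b : P) (n : ℕ),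
    d.sder1 (d.lb11 a b n) = d.lb11 (d.sder1 a) b n + sg1 i • d.lb11 a (d.sder1 b) n
  sder2_lb : ∀ (i : ZMod 2), ∀ a ∈ d.part i, ∀ (b : P) (n : ℕ),
    d.sder2 (d.lb11 a b n) = d.lb11 (d.sder2 a) b n + sg1 i • d.lb11 a (d.sder2 b) n
  comp01 : ∀ (a b : P) (n : ℕ), d.lb01 a b n = d.lb11 (d.sder1 a) b n
  comp10 : ∀ (a b : P) (n : ℕ), d.lb10 a b n = d.lb11 (d.sder2 a) b n
  comp00 : ∀ (a b : P) (n : ℕ), d.lb00 a b n = d.lb11 (d.sder2 (d.sder1 a)) b n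

/-- The conformal weight space of quasi-primary vectors for a candidate
`N=2` superconformal vector `J`: elements `a` with
`{J_Λ a} = (2∂ + 2Δλ + χD + χ̃D̃)a + O(Λ²)`. -/
def s2confWtSet (J : P) (Δ : ℝ) : Set P :=
  {a | d.lb00 J a 0 = (2 : ℂ) • d.der a ∧
       d.lb00 J a 1 = ((2 * Δ : ℝ) : ℂ) • a ∧
       d.lb10 J a 0 = -d.sder1 a ∧
       d.lb01 J a 0 = d.sder2 a}

/-- The `N=2` superconformal self-bracket relation
`{J_Λ J} = (2∂ + 2λ + χD + χ̃D̃)J + (λχχ̃/3)c` of Definition 3.4 (i),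
in components. -/
def SelfBracketRel (J : P) (c : ℂ) : Prop :=
  d.lb00 J J 0 = (2 : ℂ) • d.der J ∧
  d.lb00 J J 1 = (2 : ℂ) • J ∧
  (∀ n, 2 ≤ n → d.lb00 J J n = 0) ∧
  d.lb10 J J 0 = -d.sder1 J ∧
  (∀ n, 1 ≤ n → d.lb10 J J n = 0) ∧
  d.lb01 J J 0 = d.sder2 J ∧
  (∀ n, 1 ≤ n → d.lb01 J J n = 0) ∧
  d.lb11 J J 0 = 0 ∧
  d.lb11 J J 1 = (-(c / 3)) • (1 : P) ∧
  (∀ n, 2 ≤ n → d.lb11 J J n = 0)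

/-- `J` is an `N=2` superconformal vector of central charge `c`. -/
def IsSuperconformal (J : P) (c : ℂ) : Prop :=
  J ∈ d.part 0 ∧ d.SelfBracketRel J c ∧
  ∃ M : ℝ, (∀ Δ : ℝ, Δ < M → d.s2confWtSet J Δ ⊆ {0}) ∧
    Submodule.span ℂ (⋃ Δ : ℝ, d.s2confWtSet J Δ) = ⊤

/-- `a` is primary of conformal weight `Δ` with respect to the `N=2`
superconformal vector `J`: `{J_Λ a} = (2∂ + 2Δλ + χD + χ̃D̃)a` exactly. -/
def IsPrimary (J a : P) (Δ : ℝ) : Prop :=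
  d.lb00 J a 0 = (2 : ℂ) • d.der a ∧
  d.lb00 J a 1 = ((2 * Δ : ℝ) : ℂ) • a ∧
  (∀ n, 2 ≤ n → d.lb00 J a n = 0) ∧
  d.lb10 J a 0 = -d.sder1 a ∧
  (∀ n, 1 ≤ n → d.lb10 J a n = 0) ∧
  d.lb01 J a 0 = d.sder2 a ∧
  (∀ n, 1 ≤ n → d.lb01 J a n = 0) ∧
  (∀ n, d.lb11 J a n = 0)

end S2PVAData
/-- The `N=0` Poisson vertex algebra data induced from an `N=1` SUSY PVA
structure: the `λ`-bracket is `{a_λ b} = ∑ (λⁿ/n!) a_{(n|1)} b`. -/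
def SPVAData.toPVAData {P : Type} [Ring P] [Algebra ℂ P] (d : SPVAData P) :
    PVAData P :=
  { part := d.part, der := d.der, lb := d.lb1, bnd := d.bnd }

/-- The first `N=1` SUSY PVA data induced from an `N=2` SUSY PVA structure:
`{a_Λ b} = ∑ (λⁿ/n!)(a_{(n|01)}b + χ a_{(n|11)}b)`, with odd derivation `D`. -/
def S2PVAData.toSPVAData₁ {P : Type} [Ring P] [Algebra ℂ P] (d : S2PVAData P) :
    SPVAData P :=
  { part := d.part, der := d.der, sder := d.sder1,
    lb0 := d.lb01, lb1 := d.lb11, bnd := d.bnd }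

/-- The second `N=1` SUSY PVA data induced from an `N=2` SUSY PVA structure:
`{a_Λ̃ b} = ∑ (λⁿ/n!)(a_{(n|10)}b + χ̃ a_{(n|11)}b)`, with odd derivation `D̃`. -/
def S2PVAData.toSPVAData₂ {P : Type} [Ring P] [Algebra ℂ P] (d : S2PVAData P) :
    SPVAData P :=
  { part := d.part, der := d.der, sder := d.sder2,
    lb0 := d.lb10, lb1 := d.lb11, bnd := d.bnd }

/-- The `N=1` SUSY bracket data induced from a `λ`-bracket and an odd
endomorphism `D`: `{a_Λ b}⁻ = {Da_λ b} + χ{a_λ b}`. -/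
def PVAData.inducedSPVA {P : Type} [Ring P] [Algebra ℂ P] (d : PVAData P)
    (D : P →ₗ[ℂ] P) : SPVAData P :=
  { part := d.part, der := d.der, sder := D,
    lb0 := d.lb.comp D, lb1 := d.lb,
    bnd := fun a b => max (d.bnd (D a) b) (d.bnd a b) }

/-- The `N=2` SUSY bracket data induced from a `λ`-bracket and two odd
endomorphisms `D, D̃`:
`{a_Λ b}⁻ = {D̃Da_λ b} - χ{D̃a_λ b} + χ̃{Da_λ b} - χχ̃{a_λ b}`. -/
def PVAData.inducedS2PVA {P : Type} [Ring P] [Algebra ℂ P] (d : PVAData P)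
    (D Dt : P →ₗ[ℂ] P) : S2PVAData P :=
  { part := d.part, der := d.der, sder1 := D, sder2 := Dt,
    lb00 := d.lb.comp (Dt ∘ₗ D), lb10 := d.lb.comp Dt,
    lb01 := d.lb.comp D, lb11 := d.lb,
    bnd := fun a b =>
      max (max (d.bnd (Dt (D a)) b) (d.bnd (Dt a) b))
        (max (d.bnd (D a) b) (d.bnd a b)) }
/-- The target axioms: `(A, part, der)` is a unital supercommutative
associative differential `ℂ`-superalgebra with even derivation `der`. -/
def SuperDiffTargetOK (A : Type) [Ring A] [Algebra ℂ A]
    (part : ZMod 2 → Submodule ℂ A) (der : A →ₗ[ℂ] A) : Prop :=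
  IsCompl (part 0) (part 1) ∧ (1 : A) ∈ part 0 ∧
  (∀ (i j : ZMod 2), ∀ a ∈ part i, ∀ b ∈ part j, a * b ∈ part (i + j)) ∧
  (∀ (i j : ZMod 2), ∀ a ∈ part i, ∀ b ∈ part j, a * b = sg i j • (b * a)) ∧
  (∀ (i : ZMod 2), ∀ a ∈ part i, der a ∈ part i) ∧
  (∀ a b : A, der (a * b) = der a * b + a * der b)

/-- `(A, part)` has an odd derivation `sd` with `sd² = der`. -/
def OddDerOK (A : Type) [Ring A] [Algebra ℂ A]
    (part : ZMod 2 → Submodule ℂ A) (der sd : A →ₗ[ℂ] A) : Prop :=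
  (∀ (i : ZMod 2), ∀ a ∈ part i, sd a ∈ part (i + 1)) ∧
  (∀ (i : ZMod 2), ∀ a ∈ part i, ∀ b : A,
    sd (a * b) = sd a * b + sg1 i • (a * sd b)) ∧
  (∀ a : A, sd (sd a) = der a)

/-- The family `x : ι → P` (of parities `px`) freely generates `P` as a
`ℂ[∂]`-differential superalgebra: universal property with respect to unital
supercommutative associative differential `ℂ`-superalgebras. -/
def FreelyGenerates₀ (P : Type) [Ring P] [Algebra ℂ P]
    (part : ZMod 2 → Submodule ℂ P) (der : P →ₗ[ℂ] P)
    {ι : Type} (x : ι → P) (px : ι → ZMod 2) : Prop :=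
  ∀ (A : Type) [Ring A] [Algebra ℂ A], ∀ (pA : ZMod 2 → Submodule ℂ A)
    (dA : A →ₗ[ℂ] A), SuperDiffTargetOK A pA dA →
    ∀ y : ι → A, (∀ i, y i ∈ pA (px i)) →
    ∃! φ : P →ₐ[ℂ] A, (∀ i, φ (x i) = y i) ∧
      (∀ p : P, φ (der p) = dA (φ p)) ∧
      (∀ j : ZMod 2, ∀ a ∈ part j, φ a ∈ pA j)

/-- The family `x : ι → P` (of parities `px`) freely generates `P` as a
`ℂ[∂,D] = ℂ[∇]`-differential superalgebra (`N=1`): universal property with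
respect to supercommutative differential superalgebras with an odd derivation
`D` satisfying `D² = ∂`. -/
def FreelyGenerates₁ (P : Type) [Ring P] [Algebra ℂ P]
    (part : ZMod 2 → Submodule ℂ P) (der sder : P →ₗ[ℂ] P)
    {ι : Type} (x : ι → P) (px : ι → ZMod 2) : Prop :=
  ∀ (A : Type) [Ring A] [Algebra ℂ A], ∀ (pA : ZMod 2 → Submodule ℂ A)
    (dA sA : A →ₗ[ℂ] A), SuperDiffTargetOK A pA dA → OddDerOK A pA dA sA →
    ∀ y : ι → A, (∀ i, y i ∈ pA (px i)) →
    ∃! φ : P →ₐ[ℂ] A, (∀ i, φ (x i) = y i) ∧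
      (∀ p : P, φ (der p) = dA (φ p)) ∧
      (∀ p : P, φ (sder p) = sA (φ p)) ∧
      (∀ j : ZMod 2, ∀ a ∈ part j, φ a ∈ pA j)

/-- The family `x : ι → P` (of parities `px`) freely generates `P` as a
`ℂ[∂,D,D̃] = ℂ[∇]`-differential superalgebra (`N=2`): universal property with
respect to supercommutative differential superalgebras with two supercommuting
odd derivations `D, D̃` squaring to `∂`. -/
def FreelyGenerates₂ (P : Type) [Ring P] [Algebra ℂ P]
    (part : ZMod 2 → Submodule ℂ P) (der sder1 sder2 : P →ₗ[ℂ] P)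
    {ι : Type} (x : ι → P) (px : ι → ZMod 2) : Prop :=
  ∀ (A : Type) [Ring A] [Algebra ℂ A], ∀ (pA : ZMod 2 → Submodule ℂ A)
    (dA sA tA : A →ₗ[ℂ] A), SuperDiffTargetOK A pA dA →
    OddDerOK A pA dA sA → OddDerOK A pA dA tA →
    (∀ a : A, sA (tA a) + tA (sA a) = 0) →
    ∀ y : ι → A, (∀ i, y i ∈ pA (px i)) →
    ∃! φ : P →ₐ[ℂ] A, (∀ i, φ (x i) = y i) ∧
      (∀ p : P, φ (der p) = dA (φ p)) ∧
      (∀ p : P, φ (sder1 p) = sA (φ p)) ∧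
      (∀ p : P, φ (sder2 p) = tA (φ p)) ∧
      (∀ j : ZMod 2, ∀ a ∈ part j, φ a ∈ pA j)

/-- The operator `a ↦ G_{(0)} a` (zeroth coefficient of the `λ`-bracket with a
fixed element `G`), as a linear endomorphism. -/
def PVAData.ad0 {P : Type} [Ring P] [Algebra ℂ P] (d : PVAData P) (G : P) :
    P →ₗ[ℂ] P where
  toFun x := d.lb G x 0
  map_add' x y := by simp
  map_smul' c x := by simp

/-- The operator `a ↦ J_{(0|0)} a` (the `(0|0)`-coefficient of the
`Λ`-bracket with a fixed element `J`), as a linear endomorphism. -/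
def SPVAData.ad00 {P : Type} [Ring P] [Algebra ℂ P] (d : SPVAData P) (J : P) :
    P →ₗ[ℂ] P where
  toFun x := d.lb0 J x 0
  map_add' x y := by simp
  map_smul' c x := by simp

lemma ZMod.two_eq_zero_or_one (i : ZMod 2) : i = 0 ∨ i = 1 := by
  revert i
  decide

lemma sg_add_one_left (i j : ZMod 2) : sg (i + 1) j = sg i j * sg1 j := by
  rcases ZMod.two_eq_zero_or_one i with rfl | rfl <;>
    rcases ZMod.two_eq_zero_or_one j with rfl | rfl <;>
    simp [sg, sg1, ZMod.val_one, show (1 : ZMod 2) + 1 = 0 from rfl]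

lemma sg_add_one_right (i j : ZMod 2) : sg i (j + 1) = sg i j * sg1 i := by
  rcases ZMod.two_eq_zero_or_one i with rfl | rfl <;>
    rcases ZMod.two_eq_zero_or_one j with rfl | rfl <;>
    simp [sg, sg1, ZMod.val_one, show (1 : ZMod 2) + 1 = 0 from rfl]

lemma sg1_add_one (i : ZMod 2) : sg1 (i + 1) = -sg1 i := by
  rcases ZMod.two_eq_zero_or_one i with rfl | rfl <;>
    simp [sg1, ZMod.val_one, show (1 : ZMod 2) + 1 = 0 from rfl]

lemma sg1_mul_self (i : ZMod 2) : sg1 i * sg1 i = 1 := by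
  rcases ZMod.two_eq_zero_or_one i with rfl | rfl <;> simp [sg1, ZMod.val_one]

lemma sg1_smul_smul {M : Type*} [AddCommGroup M] [Module ℂ M] (i : ZMod 2) (x : M) :
    sg1 i • sg1 i • x = x := by
  rw [smul_smul, sg1_mul_self, one_smul]

lemma sg_one_left (j : ZMod 2) : sg 1 j = sg1 j := by
  simp [sg, sg1, ZMod.val_one]

namespace PVAData

variable {P : Type} [Ring P] [Algebra ℂ P] {d : PVAData P}

lemma IsPVA.targetOK (h : d.IsPVA) : SuperDiffTargetOK P d.part d.der :=
  ⟨h.compl, h.one_mem, h.mul_mem, h.scomm, h.der_mem, h.der_mul⟩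

lemma IsPVA.ad0_mem (h : d.IsPVA) {G : P} (hG : G ∈ d.part 1) (i : ZMod 2) (a : P)
    (ha : a ∈ d.part i) : d.ad0 G a ∈ d.part (i + 1) := by
  rw [add_comm]
  exact h.lb_mem 1 i G hG a ha 0

lemma IsPVA.ad0_mul (h : d.IsPVA) {G : P} (hG : G ∈ d.part 1) (i : ZMod 2) (a : P)
    (ha : a ∈ d.part i) (b : P) :
    d.ad0 G (a * b) = d.ad0 G a * b + sg1 i • (a * d.ad0 G b) := by
  have := h.leibniz 1 i G hG a ha b 0
  rwa [sg_one_left] at this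

lemma IsPVA.ad0_lb (h : d.IsPVA) {G : P} (hG : G ∈ d.part 1) (i : ZMod 2) (a : P)
    (ha : a ∈ d.part i) (b : P) (n : ℕ) :
    d.ad0 G (d.lb a b n) = d.lb (d.ad0 G a) b n + sg1 i • d.lb a (d.ad0 G b) n := by
  have := h.jacobi 1 i G hG a ha b 0 n
  simp only [zero_add, Finset.sum_range_one, Nat.choose_self, Nat.cast_one, one_smul,
    Nat.sub_zero, sg_one_left] at this
  exact this

/-- For an odd element `G`, the square of `G_{(0)}` is half of `(G_{(0)}G)_{(0)}`. -/
lemma IsPVA.two_smul_ad0_ad0 (h : d.IsPVA) {G : P} (hG : G ∈ d.part 1) (b : P) :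
    (2 : ℂ) • d.ad0 G (d.ad0 G b) = d.lb (d.lb G G 0) b 0 := by
  have := h.ad0_lb hG 1 G hG b 0
  simp only [sg1, ZMod.val_one, pow_one, neg_smul, one_smul] at this
  rw [two_smul]
  exact eq_sub_iff_add_eq.mp (by rw [sub_eq_add_neg]; exact this)

/-- The sum in the skewsymmetry axiom may be cut at any bound past which `{b_λ a}` vanishes. -/
lemma IsPVA.skew_of_bound (h : d.IsPVA) {i j : ZMod 2} {a b : P} (ha : a ∈ d.part i)
    (hb : b ∈ d.part j) (n N : ℕ) (hN : ∀ m, N ≤ m → d.lb b a m = 0) :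
    d.lb a b n = -sg i j • ∑ k ∈ Finset.range (N + 1),
      (((-1 : ℂ) ^ (n + k)) / (Nat.factorial k : ℂ)) •
        (d.der ^ k) (d.lb b a (n + k)) := by
  have hsum : ∀ M, (∀ m, M ≤ m → d.lb b a m = 0) →
      ∀ k, M + 1 ≤ k → (((-1 : ℂ) ^ (n + k)) / (Nat.factorial k : ℂ)) •
        (d.der ^ k) (d.lb b a (n + k)) = 0 := by
    intro M hM k hk
    rw [hM (n + k) (by omega), map_zero, smul_zero]
  rw [h.skew i j a ha b hb n,
    ← Finset.eventually_constant_sum (hsum _ (h.lb_bnd b a))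
      (Nat.succ_le_succ (le_max_left (d.bnd b a) N)),
    ← Finset.eventually_constant_sum (hsum _ hN)
      (Nat.succ_le_succ (le_max_right (d.bnd b a) N))]

/-- A PVA with an odd derivation `D` of the product and of the `λ`-bracket with `D² = ∂`
is an `N=1` SUSY PVA for the induced `Λ`-bracket. -/
lemma IsPVA.inducedSPVA_isSPVA (h : d.IsPVA) (D : P →ₗ[ℂ] P)
    (hmem : ∀ i, ∀ a ∈ d.part i, D a ∈ d.part (i + 1))
    (hmul : ∀ i, ∀ a ∈ d.part i, ∀ b, D (a * b) = D a * b + sg1 i • (a * D b))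
    (hlb : ∀ i, ∀ a ∈ d.part i, ∀ b n,
      D (d.lb a b n) = d.lb (D a) b n + sg1 i • d.lb a (D b) n)
    (hsq : ∀ a, D (D a) = d.der a) : (d.inducedSPVA D).IsSPVA := by
  have hlbD : ∀ i, ∀ a ∈ d.part i, ∀ b n,
      d.lb a (D b) n = sg1 (i + 1) • (d.lb (D a) b n - D (d.lb a b n)) := by
    intro i a ha b n
    rw [hlb i a ha, sg1_add_one, sub_add_cancel_left, smul_neg, neg_smul, neg_neg, sg1_smul_smul]
  refine
    { compl := h.compl
      one_mem := h.one_mem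
      mul_mem := h.mul_mem
      scomm := h.scomm
      der_mem := h.der_mem
      der_mul := h.der_mul
      sder_mem := hmem
      sder_mul := hmul
      sder_sq := hsq
      lb0_mem := ?_
      lb1_mem := h.lb_mem
      lb0_bnd := fun a b n hn => h.lb_bnd _ _ _ (le_trans (le_max_left _ _) hn)
      lb1_bnd := fun a b n hn => h.lb_bnd _ _ _ (le_trans (le_max_right _ _) hn)
      sesq1₀ := ?_
      sesq1 := ?_
      sesq1' := fun _ _ _ => rfl
      sesq2₀ := ?_
      sesq2 := ?_
      sesq2' := hlbD
      skew0 := ?_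
      skew1 := ?_
      jacobi00 := ?_
      jacobi10 := ?_
      jacobi01 := ?_
      jacobi11 := ?_
      leibniz0 := ?_
      leibniz1 := h.leibniz }
  all_goals simp only [inducedSPVA, LinearMap.comp_apply]
  · intro i j a ha b hb n
    rw [add_right_comm]
    exact h.lb_mem _ _ _ (hmem i a ha) b hb n
  · intro a b
    rw [hsq, h.sesq1₀]
  · intro a b n
    rw [hsq, h.sesq1]
  · intro i a ha b
    rw [hlbD _ _ (hmem i a ha), hsq, h.sesq1₀, sg1_add_one (i + 1)]
    simp
  · intro i a ha b n
    rw [hlbD _ _ (hmem i a ha), hsq, h.sesq1, sg1_add_one (i + 1), neg_smul, ← smul_neg]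
    congr 1
    rw [neg_smul]
    abel
  · intro i j a ha b hb n
    rw [h.skew_of_bound (hmem i a ha) hb n (max (d.bnd (D b) a) (d.bnd b a)) fun m hm => ?_]
    · rw [sg_add_one_left, ← mul_neg, mul_smul, Finset.smul_sum]
      congr 1
      refine Finset.sum_congr rfl fun k _ => ?_
      rw [hlbD _ _ hb, sg1_add_one, map_smul, smul_comm, neg_smul, neg_smul]
      simp only [smul_neg, neg_neg, sg1_smul_smul]
    · rw [hlbD _ _ hb, h.lb_bnd _ _ _ (le_trans (le_max_left _ _) hm),
        h.lb_bnd _ _ _ (le_trans (le_max_right _ _) hm)]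
      simp
  · intro i j a ha b hb n
    exact h.skew_of_bound ha hb n _ fun m hm => h.lb_bnd _ _ _ (le_trans (le_max_right _ _) hm)
  · intro i j a ha b hb x m n
    rw [h.jacobi _ _ _ (hmem i a ha) _ (hmem j b hb)]
    congr 1
    have e : ∀ k N, d.lb (d.lb (D a) (D b) k) x N =
        sg1 (i + 1) • (d.lb (D (d.lb (D a) b k)) x N - d.lb (d.lb (d.der a) b k) x N) := by
      intro k N
      rw [hlbD _ _ (hmem i a ha), hsq, sg1_add_one (i + 1), neg_smul, ← smul_neg, neg_sub,
        map_smul, map_sub]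
      rfl
    simp only [e, smul_comm _ (sg1 (i + 1)), ← Finset.smul_sum, smul_sub, Finset.sum_sub_distrib]
    rw [smul_add, ← smul_sub, sub_eq_add_neg, smul_add]
    congr 2
    rw [Finset.sum_range_succ', h.sesq1₀, map_zero, LinearMap.zero_apply, Pi.zero_apply,
      smul_zero, add_zero, ← Finset.sum_neg_distrib]
    refine Finset.sum_congr rfl fun k _ => ?_
    rw [h.sesq1, map_smul, LinearMap.smul_apply, Pi.smul_apply, neg_smul, smul_neg, neg_neg,
      smul_smul, ← Nat.cast_mul, mul_comm, Nat.sub_sub]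
  · intro i j a ha b hb x m n
    rw [h.jacobi _ _ _ ha _ (hmem j b hb), Finset.smul_sum]
    congr 1
    · refine Finset.sum_congr rfl fun k _ => ?_
      rw [hlbD _ _ ha, map_smul, map_sub, LinearMap.smul_apply, LinearMap.sub_apply,
        Pi.smul_apply, Pi.sub_apply, smul_comm]
    · rw [sg_add_one_left, mul_assoc, sg1_mul_self, mul_one]
  · intro i j a ha b hb x m n
    rw [h.jacobi _ _ _ (hmem i a ha) _ hb, smul_add, smul_smul, sg_add_one_right, mul_comm]
  · intro i j a ha b hb x m n
    rw [h.jacobi _ _ _ ha _ hb, smul_add, smul_smul, sg_add_one_left, mul_assoc, sg1_mul_self,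
      mul_one, sg_add_one_right, mul_comm]
  · intro i j a ha b hb x n
    exact h.leibniz _ _ _ (hmem i a ha) b hb x n

end PVAData

/-- Induction principle: a graded differential subalgebra containing free generators is
everything. -/
lemma FreelyGenerates₀.eq_top {P : Type} [Ring P] [Algebra ℂ P]
    {part : ZMod 2 → Submodule ℂ P} {der : P →ₗ[ℂ] P} (hP : SuperDiffTargetOK P part der)
    {ι : Type} {x : ι → P} {px : ι → ZMod 2} (hfree : FreelyGenerates₀ P part der x px)
    (hx : ∀ i, x i ∈ part (px i)) (S : Subalgebra ℂ P) (hxS : ∀ i, x i ∈ S)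
    (hder : ∀ p ∈ S, der p ∈ S)
    (hgr : ∀ p ∈ part 0, ∀ q ∈ part 1, p + q ∈ S → p ∈ S) : S = ⊤ := by
  obtain ⟨hcompl, hone, hmul, hcomm, hdmem, hdmul⟩ := hP
  let pS : ZMod 2 → Submodule ℂ S := fun j => (part j).comap S.val.toLinearMap
  let dS : S →ₗ[ℂ] S := der.restrict (p := Subalgebra.toSubmodule S)
    (q := Subalgebra.toSubmodule S) hder
  have hS : SuperDiffTargetOK S pS dS := by
    refine ⟨⟨?_, ?_⟩, hone, fun i j a ha b hb => hmul i j a ha b hb,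
      fun i j a ha b hb => Subtype.ext (hcomm i j a ha b hb),
      fun i a ha => hdmem i a ha, fun a b => Subtype.ext (hdmul a b)⟩
    · rw [Submodule.disjoint_def]
      intro s hs0 hs1
      exact Subtype.ext (Submodule.disjoint_def.mp hcompl.disjoint s hs0 hs1)
    · rw [codisjoint_iff, eq_top_iff]
      rintro ⟨s, hs⟩ -
      obtain ⟨p, hp, q, hq, rfl⟩ := Submodule.mem_sup.mp
        ((codisjoint_iff.mp hcompl.codisjoint).ge (Submodule.mem_top (x := s)))
      have hpS := hgr p hp q hq hs
      have hqS : q ∈ S := by simpa using S.sub_mem hs hpS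
      exact Submodule.mem_sup.mpr ⟨⟨p, hpS⟩, hp, ⟨q, hqS⟩, hq, rfl⟩
  obtain ⟨φ, ⟨hφx, hφd, hφp⟩, -⟩ := hfree S pS dS hS (fun i => ⟨x i, hxS i⟩) hx
  have hid : S.val.comp φ = AlgHom.id ℂ P := by
    refine (hfree P part der ⟨hcompl, hone, hmul, hcomm, hdmem, hdmul⟩ x hx).unique
      ⟨fun i => ?_, fun p => ?_, fun j a ha => hφp j a ha⟩
      ⟨fun i => rfl, fun p => rfl, fun j a ha => ha⟩
    · simp [hφx]
    · simp only [AlgHom.comp_apply, hφd]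
      rfl
  refine eq_top_iff.mpr fun p _ => ?_
  have := congrArg (fun ψ : P →ₐ[ℂ] P => ψ p) hid
  simp only [AlgHom.comp_apply, AlgHom.id_apply] at this
  rw [← this]
  exact (φ p).2

/-- A free even generator is nonzero. -/
lemma FreelyGenerates₀.ne_zero {P : Type} [Ring P] [Algebra ℂ P]
    {part : ZMod 2 → Submodule ℂ P} {der : P →ₗ[ℂ] P}
    {ι : Type} {x : ι → P} {px : ι → ZMod 2} (hfree : FreelyGenerates₀ P part der x px)
    (i : ι) (hi : px i = 0) : x i ≠ 0 := by
  classical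
  intro h0
  have hC : SuperDiffTargetOK ℂ (fun j : ZMod 2 => if j = 0 then ⊤ else ⊥) 0 := by
    refine ⟨by simpa using isCompl_top_bot, by simp, ?_, ?_, by simp, by simp⟩
    · intro i j a ha b hb
      by_cases hi : i = 0 <;> by_cases hj : j = 0 <;> simp_all
    · intro i j a ha b hb
      by_cases hi : i = 0 <;> by_cases hj : j = 0 <;> simp_all [sg, mul_comm]
  obtain ⟨φ, ⟨hφ, -⟩, -⟩ := hfree ℂ _ 0 hC (fun k => if k = i then 1 else 0) (by
    intro k
    by_cases hk : k = i
    · subst hk; simp [hi]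
    · simp [hk])
  simpa [h0] using hφ i

/-- Let `P` be a Poisson vertex algebra with conformal
vector `L` of central charge `c`.  Suppose there exist `L`-primary elements
`G` and `a_i` (`i ∈ ι`) with `G` odd, `{G_λ G} = L + (λ²/3)c`,
`{G_λ a_i} = G_{(0)} a_i`, such that `{G, L} ∪ {a_i, G_{(0)}a_i}` freely
generates `P` as a `ℂ[∂]`-differential algebra.  Then, for `D := G_{(0)}`,
`P` with the induced `Λ`-bracket `{a_Λ b} = {Da_λ b} + χ{a_λ b}` is an `N=1`
SUSY PVA with `N=1` superconformal vector `G`; moreover `P` is freely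
generated by `{G} ∪ {a_i}` as a `ℂ[∂,D]`-algebra, with all `a_i`
`G`-primary. -/
theorem stmt_7 {P : Type} [Ring P] [Algebra ℂ P] (d : PVAData P) (h : d.IsPVA)
    (L : P) (c : ℂ) (hL : d.IsConformalVector L c)
    {ι : Type} (a : ι → P) (pa : ι → ZMod 2) (ha : ∀ i, a i ∈ d.part (pa i))
    (G : P) (hGodd : G ∈ d.part 1)
    (Δa : ι → ℝ) (haprim : ∀ i, d.IsPrimary L (a i) (Δa i))
    (ΔG : ℝ) (hGprim : d.IsPrimary L G ΔG)
    -- `{G_λ G} = L + (λ²/3)c`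
    (hGG0 : d.lb G G 0 = L) (hGG1 : d.lb G G 1 = 0)
    (hGG2 : d.lb G G 2 = (2 * c / 3) • (1 : P))
    (hGGn : ∀ n, 3 ≤ n → d.lb G G n = 0)
    -- `{G_λ a_i} = G_{(0)} a_i`
    (hGa : ∀ i, ∀ n, 1 ≤ n → d.lb G (a i) n = 0)
    -- `{G, L} ∪ {a_i, G_{(0)}a_i : i}` freely generates `P` as a
    -- `ℂ[∂]`-differential algebra
    (hfree : FreelyGenerates₀ P d.part d.der
      (fun z : (ι ⊕ ι) ⊕ Bool => match z with
        | Sum.inl (Sum.inl i) => a i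
        | Sum.inl (Sum.inr i) => d.lb G (a i) 0
        | Sum.inr true => G
        | Sum.inr false => L)
      (fun z => match z with
        | Sum.inl (Sum.inl i) => pa i
        | Sum.inl (Sum.inr i) => pa i + 1
        | Sum.inr true => 1
        | Sum.inr false => 0)) :
    (d.inducedSPVA (d.ad0 G)).IsSPVA ∧
    (d.inducedSPVA (d.ad0 G)).IsSuperconformal G c ∧
    FreelyGenerates₁ P d.part d.der (d.ad0 G)
      (fun z : Option ι => match z with | none => G | some i => a i)
      (fun z => match z with | none => 1 | some i => pa i) ∧
    (∀ i, ∃ Δ : ℝ, (d.inducedSPVA (d.ad0 G)).IsPrimary G (a i) Δ) := by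
  have hmem := h.ad0_mem hGodd
  have hmul := h.ad0_mul hGodd
  have hlb := h.ad0_lb hGodd
  have hDG : d.ad0 G G = L := hGG0
  obtain ⟨hLeven, hLL0, hLL1, -, -, -, M, hM, hspan⟩ := hL
  have hL0 : ∀ p, d.lb L p 0 = (2 : ℂ) • d.der p := by
    intro p
    have : d.ad0 L = (2 : ℂ) • d.der := by
      refine LinearMap.ext_on hspan fun q hq => ?_
      obtain ⟨Δ, hq⟩ := Set.mem_iUnion.mp hq
      exact hq.1
    exact congrArg (fun f : P →ₗ[ℂ] P => f p) this
  have hsq : ∀ p, d.ad0 G (d.ad0 G p) = d.der p := by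
    intro p
    have := h.two_smul_ad0_ad0 hGodd p
    rw [hGG0, hL0] at this
    exact smul_right_injective P (two_ne_zero (α := ℂ)) this
  have hLne : L ≠ 0 := hfree.ne_zero (Sum.inr false) rfl
  have hΔG : ((2 * ΔG : ℝ) : ℂ) = 3 := by
    have hJ := h.jacobi 0 1 L hLeven G hGodd G 1 0
    have hs : sg 0 1 = 1 := by simp [sg]
    have h1 := h.sesq1 G G 0
    simp only [Finset.sum_range_succ, Finset.range_zero, Finset.sum_empty, hGG0, hLL1, hGprim.1,
      hGprim.2.1, hs, map_smul, LinearMap.smul_apply, Pi.smul_apply] at hJ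
    norm_num at h1 hJ
    rw [h1, hGG0] at hJ
    have h2 : (4 * (ΔG : ℂ) - 6) • L = 0 := by
      refine Eq.trans ?_ (sub_eq_zero.mpr hJ.symm)
      module
    rcases smul_eq_zero.mp h2 with h3 | h3
    · push_cast
      linear_combination h3 / 2
    · exact absurd h3 hLne
  refine ⟨h.inducedSPVA_isSPVA _ hmem hmul hlb hsq, ?_, ?_, ?_⟩
  · refine ⟨hGodd, ?_, ?_, ?_, rfl, hGG1, hGG2, hGGn, M, fun Δ hΔ q hq => ?_, ?_⟩
    · change d.lb (d.ad0 G G) G 0 = _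
      rw [hDG]
      exact hGprim.1
    · change d.lb (d.ad0 G G) G 1 = _
      rw [hDG, ← hΔG]
      exact hGprim.2.1
    · intro n hn
      change d.lb (d.ad0 G G) G n = _
      rw [hDG]
      exact hGprim.2.2 n hn
    · obtain ⟨h0, h1, -⟩ := hq
      change d.lb (d.ad0 G G) q 0 = _ at h0
      change d.lb (d.ad0 G G) q 1 = _ at h1
      rw [hDG] at h0 h1
      exact hM Δ hΔ ⟨h0, h1⟩
    · rw [eq_top_iff, ← hspan]
      refine Submodule.span_mono (Set.iUnion_mono fun Δ q hq => ⟨?_, ?_, rfl⟩)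
      · change d.lb (d.ad0 G G) q 0 = _
        rw [hDG]
        exact hq.1
      · change d.lb (d.ad0 G G) q 1 = _
        rw [hDG]
        exact hq.2
  · intro A _ _ pA dA sA hA hsA y hy
    obtain ⟨φ, ⟨hφx, hφd, hφp⟩, hφu⟩ := hfree A pA dA hA
      (fun z => match z with
        | Sum.inl (Sum.inl i) => y (some i)
        | Sum.inl (Sum.inr i) => sA (y (some i))
        | Sum.inr true => y none
        | Sum.inr false => sA (y none)) (by
        rintro ((i | i) | (_ | _))
        · exact hy (some i)
        · exact hsA.1 _ _ (hy (some i))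
        · exact hsA.1 _ _ (hy none)
        · exact hy none)
    have hφa : ∀ i, φ (a i) = y (some i) := fun i => hφx (Sum.inl (Sum.inl i))
    have hφDa : ∀ i, φ (d.ad0 G (a i)) = sA (y (some i)) := fun i => hφx (Sum.inl (Sum.inr i))
    have hφG : φ G = y none := hφx (Sum.inr true)
    have hφL : φ L = sA (y none) := hφx (Sum.inr false)
    have hgr : ∀ p ∈ d.part 0, ∀ q ∈ d.part 1,
        φ (d.ad0 G (p + q)) = sA (φ (p + q)) →
        φ (d.ad0 G p) = sA (φ p) ∧ φ (d.ad0 G q) = sA (φ q) := by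
      intro p hp q hq hpq
      simp only [map_add] at hpq
      have e : φ (d.ad0 G p) - sA (φ p) = sA (φ q) - φ (d.ad0 G q) := by
        rw [sub_eq_sub_iff_add_eq_add, hpq, add_comm]
      have m1 : φ (d.ad0 G p) - sA (φ p) ∈ pA 1 :=
        sub_mem (hφp _ _ (hmem 0 p hp)) (hsA.1 0 _ (hφp _ _ hp))
      have m0 : φ (d.ad0 G p) - sA (φ p) ∈ pA 0 := by
        rw [e]
        exact sub_mem (hsA.1 1 _ (hφp _ _ hq)) (hφp _ _ (hmem 1 q hq))
      have z := Submodule.disjoint_def.mp hA.1.disjoint _ m0 m1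
      exact ⟨sub_eq_zero.mp z, (sub_eq_zero.mp (e ▸ z)).symm⟩
    have hhom : ∀ j, ∀ p ∈ d.part j, ∀ q, φ (d.ad0 G p) = sA (φ p) →
        φ (d.ad0 G q) = sA (φ q) → φ (d.ad0 G (p * q)) = sA (φ (p * q)) := by
      intro j p hp q hDp hDq
      rw [hmul j p hp, map_mul, hsA.2.1 j _ (hφp _ _ hp)]
      simp [hDp, hDq]
    have hone : φ (d.ad0 G 1) = sA (φ 1) := by
      have e1 := hmul 0 1 h.one_mem 1
      have e2 := hsA.2.1 0 1 hA.2.1 1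
      simp [sg1] at e1 e2
      simp [e1, e2]
    let S : Subalgebra ℂ P :=
      { carrier := {p | φ (d.ad0 G p) = sA (φ p)}
        mul_mem' := by
          intro p q hp hq
          obtain ⟨p0, hp0, p1, hp1, rfl⟩ := Submodule.mem_sup.mp
            ((codisjoint_iff.mp h.compl.codisjoint).ge (Submodule.mem_top (x := p)))
          obtain ⟨e0, e1⟩ := hgr p0 hp0 p1 hp1 hp
          simp only [Set.mem_ofPred_eq, add_mul, map_add, hhom 0 p0 hp0 q e0 hq,
            hhom 1 p1 hp1 q e1 hq]
        add_mem' := by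
          intro p q hp hq
          simp only [Set.mem_ofPred_eq, map_add] at hp hq ⊢
          rw [hp, hq]
        algebraMap_mem' := by
          intro r
          simp only [Algebra.algebraMap_eq_smul_one, Set.mem_ofPred_eq, map_smul, hone] }
    have hS : S = ⊤ := by
      refine hfree.eq_top h.targetOK ?_ S ?_ ?_ fun p hp q hq hpq => (hgr p hp q hq hpq).1
      · rintro ((i | i) | (_ | _))
        · exact ha i
        · exact hmem _ _ (ha i)
        · exact hLeven
        · exact hGodd
      · rintro ((i | i) | (_ | _))
        · change φ (d.ad0 G (a i)) = sA (φ (a i))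
          rw [hφDa, hφa]
        · change φ (d.ad0 G (d.ad0 G (a i))) = sA (φ (d.ad0 G (a i)))
          rw [hφDa, hsq, hφd, hsA.2.2, hφa]
        · change φ (d.ad0 G L) = sA (φ L)
          rw [hφL, ← hDG, hsq, hφd, hsA.2.2, hφG]
        · change φ (d.ad0 G G) = sA (φ G)
          rw [hDG, hφL, hφG]
      · intro p hp
        change φ (d.ad0 G p) = sA (φ p) at hp
        change φ (d.ad0 G (d.der p)) = sA (φ (d.der p))
        have hcomm : d.ad0 G (d.der p) = d.der (d.ad0 G p) := h.sesq2₀ G p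
        rw [hcomm, hφd, hp, hφd, ← hsA.2.2, ← hsA.2.2]
    refine ⟨φ, ⟨?_, hφd, ?_, hφp⟩, ?_⟩
    · rintro (_ | i)
      · exact hφG
      · exact hφa i
    · intro p
      have : p ∈ S := hS ▸ Algebra.mem_top
      exact this
    · rintro ψ ⟨hψx, hψd, hψs, hψp⟩
      have hψa : ∀ i, ψ (a i) = y (some i) := fun i => hψx (some i)
      have hψG : ψ G = y none := hψx none
      refine hφu ψ ⟨?_, hψd, hψp⟩
      rintro ((i | i) | (_ | _))
      · exact hψa i
      · exact (hψs (a i)).trans (by rw [hψa])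
      · change ψ L = sA (y none)
        rw [← hDG, hψs, hψG]
      · exact hψG
  · intro i
    obtain ⟨h0, h1, h2⟩ := haprim i
    refine ⟨Δa i, ?_, ?_, fun n hn => ?_, rfl, hGa i⟩
    · change d.lb (d.ad0 G G) (a i) 0 = _
      rw [hDG]
      exact h0
    · change d.lb (d.ad0 G G) (a i) 1 = _
      rw [hDG]
      exact h1
    · change d.lb (d.ad0 G G) (a i) n = _
      rw [hDG]
      exact h2 n hn
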